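/- Let n ≥ 3 be an integer. There exists ε₀ ∈ (0, 1] such that for every ε ∈ (0, ε₀] and every x ∈ ℝ^n with ε ≤ |x| < 2ε, the function f(y) = exp(−(n+2)/(2ε − |y|)), defined for |y| < 2ε, satisfies all three of: Δf(x) ≥ (n+2)·(2ε − |x|)^{−4}·f(x); |∇f(x)| ≤ (n+2)·ε²·(2ε − |x|)^{−4}·f(x); and |D²f(x)| ≤ √n·(n+2)²·(2ε − |x|)^{−4}·f(x). -/

import Mathlib

open MeasureTheory Real Filter Topology Finset

noncomputable section

/-- Partial derivative of `f` in the `i`-th coordinate direction. -/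
def pd {n : ℕ} (i : Fin n) (f : EuclideanSpace ℝ (Fin n) → ℝ)
    (x : EuclideanSpace ℝ (Fin n)) : ℝ :=
  fderiv ℝ f x (EuclideanSpace.single i 1)

/-- The closed upper half-space `{x : x iN ≥ 0}`. -/
def halfSpace {n : ℕ} (iN : Fin n) : Set (EuclideanSpace ℝ (Fin n)) :=
  {x | 0 ≤ x iN}

/-- The boundary hyperplane `{x : x iN = 0}`. -/
def bdry {n : ℕ} (iN : Fin n) : Set (EuclideanSpace ℝ (Fin n)) :=
  {x | x iN = 0}

/-- Christoffel symbols `Γ^k_{ij}` of a metric `g`. -/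
def christoffel {n : ℕ} (g : EuclideanSpace ℝ (Fin n) → Matrix (Fin n) (Fin n) ℝ)
    (k i j : Fin n) (x : EuclideanSpace ℝ (Fin n)) : ℝ :=
  (1 / 2) * ∑ l, (g x)⁻¹ k l *
    (pd i (fun y => g y j l) x + pd j (fun y => g y i l) x - pd l (fun y => g y i j) x)

/-- The Laplace–Beltrami operator of the metric `g`. -/
def laplaceBeltrami {n : ℕ} (g : EuclideanSpace ℝ (Fin n) → Matrix (Fin n) (Fin n) ℝ)
    (u : EuclideanSpace ℝ (Fin n) → ℝ) (x : EuclideanSpace ℝ (Fin n)) : ℝ :=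
  ∑ i, ∑ j, (g x)⁻¹ i j *
    (pd i (pd j u) x - ∑ k, christoffel g k i j x * pd k u x)

/-- The inward-pointing `g`-unit normal to the boundary hyperplane, as a vector. -/
def nuVec {n : ℕ} (iN : Fin n) (g : EuclideanSpace ℝ (Fin n) → Matrix (Fin n) (Fin n) ℝ)
    (y : EuclideanSpace ℝ (Fin n)) : EuclideanSpace ℝ (Fin n) :=
  (WithLp.equiv 2 (Fin n → ℝ)).symm fun i =>
    (g y)⁻¹ i iN / Real.sqrt ((g y)⁻¹ iN iN)

/-- Normal derivative `D_{ν_g} u` at a boundary point. -/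
def nuDeriv {n : ℕ} (iN : Fin n) (g : EuclideanSpace ℝ (Fin n) → Matrix (Fin n) (Fin n) ℝ)
    (u : EuclideanSpace ℝ (Fin n) → ℝ) (y : EuclideanSpace ℝ (Fin n)) : ℝ :=
  ∑ i, nuVec iN g y i * pd i u y

/-- `g` is a `C^m` Riemannian metric on the half-space. -/
def IsCmMetric {n : ℕ} (m : ℕ) (iN : Fin n)
    (g : EuclideanSpace ℝ (Fin n) → Matrix (Fin n) (Fin n) ℝ) : Prop :=
  (∀ i j, ContDiffOn ℝ m (fun y => g y i j) (halfSpace iN)) ∧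
    ∀ x ∈ halfSpace iN, (g x).IsSymm ∧ (g x).PosDef

/-- `g` is `C²`-asymptotically flat of rate `τ` on the half-space. -/
def IsAsymptoticallyFlat {n : ℕ} (iN : Fin n) (τ : ℝ)
    (g : EuclideanSpace ℝ (Fin n) → Matrix (Fin n) (Fin n) ℝ) : Prop :=
  ∃ C₀ > 0, ∀ x ∈ halfSpace iN, 1 ≤ ‖x‖ →
    (∀ i j, |g x i j - (1 : Matrix (Fin n) (Fin n) ℝ) i j| ≤ C₀ * ‖x‖ ^ (-τ)) ∧
    (∀ i j k, |pd k (fun y => g y i j) x| ≤ C₀ * ‖x‖ ^ (-1 - τ)) ∧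
    (∀ i j k l, |pd l (pd k (fun y => g y i j)) x| ≤ C₀ * ‖x‖ ^ (-2 - τ))

/-- The closed upper half-sphere of radius `lam`. -/
def halfSphere {n : ℕ} (iN : Fin n) (lam : ℝ) : Set (EuclideanSpace ℝ (Fin n)) :=
  {x | ‖x‖ = lam ∧ 0 ≤ x iN}

/-- The flux integral `∫_{ℝⁿ₊ ∩ S_λ} Σᵢ xⁱ ∂ᵢu dμ(ḡ)`, with `dμ(ḡ)` the
`(n-1)`-dimensional Euclidean (Hausdorff) surface measure. -/
def flux {n : ℕ} (iN : Fin n) (u : EuclideanSpace ℝ (Fin n) → ℝ) (lam : ℝ) : ℝ :=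
  ∫ x in halfSphere iN lam, (∑ i, x i * pd i u x) ∂(μH[(n : ℝ) - 1])

/-- Euclidean norm of the gradient. -/
def gradNorm {n : ℕ} (u : EuclideanSpace ℝ (Fin n) → ℝ) (x : EuclideanSpace ℝ (Fin n)) : ℝ :=
  Real.sqrt (∑ i, (pd i u x) ^ 2)

/-- Frobenius norm of the Hessian. -/
def hessNorm {n : ℕ} (u : EuclideanSpace ℝ (Fin n) → ℝ) (x : EuclideanSpace ℝ (Fin n)) : ℝ :=
  Real.sqrt (∑ i, ∑ j, (pd i (pd j u) x) ^ 2)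

/-- The Euclidean Laplacian. -/
def euclLap {n : ℕ} (u : EuclideanSpace ℝ (Fin n) → ℝ) (x : EuclideanSpace ℝ (Fin n)) : ℝ :=
  ∑ i, pd i (pd i u) x

/-- The barrier function associated to `τ` and `η`. -/
def barrier {n : ℕ} (iN : Fin n) (τ : ℝ) (η : ℝ → ℝ)
    (x : EuclideanSpace ℝ (Fin n)) : ℝ :=
  -(Real.log ‖x‖)⁻¹ * ‖x‖ ^ ((2 : ℝ) - n) + η (x iN / ‖x‖) * ‖x‖ ^ ((2 : ℝ) - n - τ)

/-- The Euclidean area of the unit `(n-1)`-sphere in `ℝⁿ`. -/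
def sphereArea (n : ℕ) : ℝ :=
  (μH[(n : ℝ) - 1] (Metric.sphere (0 : EuclideanSpace ℝ (Fin n)) 1)).toReal

/-- The quantity whose limit (after normalization) is the half-space mass. -/
def massExpr {n : ℕ} (iN : Fin n)
    (g : EuclideanSpace ℝ (Fin n) → Matrix (Fin n) (Fin n) ℝ) (lam : ℝ) : ℝ :=
  lam⁻¹ *
    ((∫ x in halfSphere iN lam,
        (∑ i, ∑ j, x i * (pd j (fun y => g y i j) x - pd i (fun y => g y j j) x))
        ∂(μH[(n : ℝ) - 1])) +
      ∫ x in {x : EuclideanSpace ℝ (Fin n) | ‖x‖ = lam ∧ x iN = 0},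
        (∑ i ∈ Finset.univ.erase iN, x i * g x i iN) ∂(μH[(n : ℝ) - 2]))

/-- `m` is the half-space (ADM-type) mass of `g`. -/
def HasHalfSpaceMass {n : ℕ} (iN : Fin n)
    (g : EuclideanSpace ℝ (Fin n) → Matrix (Fin n) (Fin n) ℝ) (m : ℝ) : Prop :=
  Filter.Tendsto (fun lam => (2 * ((n : ℝ) - 1) * sphereArea n)⁻¹ * massExpr iN g lam)
    Filter.atTop (nhds m)

/-- Membership in the weighted Hölder space `C^{2,α}_τ(ℝⁿ₊)`. -/
def MemC2AlphaTau {n : ℕ} (iN : Fin n) (α τ : ℝ)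
    (u : EuclideanSpace ℝ (Fin n) → ℝ) : Prop :=
  ContDiffOn ℝ 2 u (halfSpace iN) ∧
  ∃ C₁ > 0,
    (∀ x ∈ halfSpace iN,
      |u x| ≤ C₁ * (1 + ‖x‖) ^ (-τ) ∧
      (∀ i, |pd i u x| ≤ C₁ * (1 + ‖x‖) ^ (-1 - τ)) ∧
      (∀ i j, |pd i (pd j u) x| ≤ C₁ * (1 + ‖x‖) ^ (-2 - τ))) ∧
    ∀ x₁ ∈ halfSpace iN, ∀ x₂ ∈ halfSpace iN, 1 ≤ ‖x₁‖ → 2 * ‖x₁ - x₂‖ ≤ ‖x₁‖ →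
      ∀ i j, |pd i (pd j u) x₁ - pd i (pd j u) x₂| ≤
        C₁ * ‖x₁ - x₂‖ ^ α * ‖x₁‖ ^ (-2 - τ - α)

lemma hasFDerivAt_norm_euclidean {n : ℕ} {x : EuclideanSpace ℝ (Fin n)} (hx : x ≠ 0) :
    HasFDerivAt (fun y : EuclideanSpace ℝ (Fin n) => ‖y‖) (‖x‖⁻¹ • innerSL ℝ x) x := by
  have hr : ‖x‖ ≠ 0 := norm_ne_zero_iff.2 hx
  have h := ((hasStrictFDerivAt_norm_sq x).hasFDerivAt).sqrt (pow_ne_zero 2 hr)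
  simp only [Real.sqrt_sq (norm_nonneg _)] at h
  refine h.congr_fderiv ?_
  ext v
  simp
  field_simp

lemma pd_radial {n : ℕ} (i : Fin n) {φ : ℝ → ℝ} {d : ℝ} {x : EuclideanSpace ℝ (Fin n)}
    (hx : x ≠ 0) (hφ : HasDerivAt φ d ‖x‖) :
    pd i (fun y => φ ‖y‖) x = d / ‖x‖ * x i := by
  have h := hφ.comp_hasFDerivAt x (hasFDerivAt_norm_euclidean hx)
  have h' : fderiv ℝ (fun y : EuclideanSpace ℝ (Fin n) => φ ‖y‖) x = _ := h.fderiv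
  rw [pd, h']
  simp [EuclideanSpace.inner_single_right]
  ring

lemma pd_radial_mul_coord {n : ℕ} (i j : Fin n) {a : ℝ → ℝ} {d : ℝ}
    {x : EuclideanSpace ℝ (Fin n)} (hx : x ≠ 0) (ha : HasDerivAt a d ‖x‖) :
    pd i (fun y => a ‖y‖ * y j) x =
      d / ‖x‖ * x i * x j + if i = j then a ‖x‖ else 0 := by
  have h := ha.comp_hasFDerivAt x (hasFDerivAt_norm_euclidean hx)
  have hc : HasFDerivAt (fun y : EuclideanSpace ℝ (Fin n) => y j)
      (EuclideanSpace.proj (𝕜 := ℝ) j) x := (EuclideanSpace.proj (𝕜 := ℝ) j).hasFDerivAt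
  have h' : fderiv ℝ (fun y : EuclideanSpace ℝ (Fin n) => a ‖y‖ * y j) x = _ := (h.mul hc).fderiv
  rw [pd, h']
  by_cases hij : i = j
  · subst hij
    simp [EuclideanSpace.inner_single_right]
    ring
  · simp [EuclideanSpace.inner_single_right, hij, Ne.symm hij]
    ring

/-- Second derivatives of a radial function away from the origin. -/
lemma pd_pd_radial {n : ℕ} (i j : Fin n) {φ ψ : ℝ → ℝ} {d : ℝ}
    {x : EuclideanSpace ℝ (Fin n)} (hx : x ≠ 0)
    (hφ : ∀ᶠ r in 𝓝 ‖x‖, HasDerivAt φ (ψ r) r) (hψ : HasDerivAt ψ d ‖x‖) :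
    pd i (pd j (fun y => φ ‖y‖)) x =
      (d - ψ ‖x‖ / ‖x‖) / ‖x‖ ^ 2 * x i * x j + if i = j then ψ ‖x‖ / ‖x‖ else 0 := by
  have hr : ‖x‖ ≠ 0 := norm_ne_zero_iff.2 hx
  have heq : pd j (fun y => φ ‖y‖) =ᶠ[𝓝 x] fun y => (fun r => ψ r / r) ‖y‖ * y j := by
    filter_upwards [continuous_norm.continuousAt.eventually hφ, isOpen_ne.mem_nhds hx]
      with y hy hy0
    exact pd_radial j hy0 hy
  have hcongr : pd i (pd j (fun y => φ ‖y‖)) x =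
      pd i (fun y => (fun r => ψ r / r) ‖y‖ * y j) x := by
    rw [pd, heq.fderiv_eq, pd]
  have ha : HasDerivAt (fun r => ψ r / r) ((d - ψ ‖x‖ / ‖x‖) / ‖x‖) ‖x‖ := by
    refine (hψ.div (hasDerivAt_id ‖x‖) hr).congr_deriv ?_
    simp only [id]
    field_simp
  rw [hcongr, pd_radial_mul_coord i j hx ha, div_div, ← sq]

lemma euclLap_radial {n : ℕ} {φ ψ : ℝ → ℝ} {d : ℝ}
    {x : EuclideanSpace ℝ (Fin n)} (hx : x ≠ 0)
    (hφ : ∀ᶠ r in 𝓝 ‖x‖, HasDerivAt φ (ψ r) r) (hψ : HasDerivAt ψ d ‖x‖) :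
    euclLap (fun y => φ ‖y‖) x = d + ((n : ℝ) - 1) * (ψ ‖x‖ / ‖x‖) := by
  have hr : ‖x‖ ≠ 0 := norm_ne_zero_iff.2 hx
  have hsum : ∑ i, x i * x i = ‖x‖ ^ 2 := by
    rw [EuclideanSpace.real_norm_sq_eq]
    exact sum_congr rfl fun i _ => (sq _).symm
  simp only [euclLap, pd_pd_radial _ _ hx hφ hψ, if_true, sum_add_distrib, mul_assoc, ← mul_sum,
    hsum, sum_const, card_univ, Fintype.card_fin, nsmul_eq_mul]
  field_simp
  ring

lemma gradNorm_radial {n : ℕ} {φ : ℝ → ℝ} {d : ℝ} {x : EuclideanSpace ℝ (Fin n)}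
    (hx : x ≠ 0) (hφ : HasDerivAt φ d ‖x‖) :
    gradNorm (fun y => φ ‖y‖) x = |d| := by
  have hr : ‖x‖ ≠ 0 := norm_ne_zero_iff.2 hx
  simp only [gradNorm, pd_radial _ hx hφ, mul_pow, ← mul_sum, ← EuclideanSpace.real_norm_sq_eq]
  rw [← mul_pow, div_mul_cancel₀ _ hr, Real.sqrt_sq_eq_abs]

lemma hessNorm_radial {n : ℕ} {φ ψ : ℝ → ℝ} {d : ℝ}
    {x : EuclideanSpace ℝ (Fin n)} (hx : x ≠ 0)
    (hφ : ∀ᶠ r in 𝓝 ‖x‖, HasDerivAt φ (ψ r) r) (hψ : HasDerivAt ψ d ‖x‖) :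
    hessNorm (fun y => φ ‖y‖) x =
      Real.sqrt (d ^ 2 + ((n : ℝ) - 1) * (ψ ‖x‖ / ‖x‖) ^ 2) := by
  have hr : ‖x‖ ≠ 0 := norm_ne_zero_iff.2 hx
  simp only [hessNorm, pd_pd_radial _ _ hx hφ hψ]
  congr 1
  set b := ψ ‖x‖ / ‖x‖
  set c := (d - b) / ‖x‖ ^ 2 with hc
  have hterm : ∀ i j : Fin n, (c * x i * x j + if i = j then b else 0) ^ 2 =
      c ^ 2 * x i ^ 2 * x j ^ 2 + if i = j then 2 * c * b * x i ^ 2 + b ^ 2 else 0 := by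
    intro i j
    split_ifs with h
    · subst h
      ring
    · ring
  simp only [hterm, sum_add_distrib, sum_ite_eq, mem_univ, if_true, ← mul_sum, ← sum_mul,
    ← EuclideanSpace.real_norm_sq_eq, sum_const, card_univ, Fintype.card_fin, nsmul_eq_mul]
  rw [hc]
  field_simp
  ring

lemma hasDerivAt_exp_neg_div_sub (N R : ℝ) {r : ℝ} (hr : r < R) :
    HasDerivAt (fun t => Real.exp (-N / (R - t)))
      (-N / (R - r) ^ 2 * Real.exp (-N / (R - r))) r := by
  have hs : R - r ≠ 0 := (sub_pos.2 hr).ne'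
  refine (((hasDerivAt_const r (-N)).div ((hasDerivAt_id r).const_sub R) hs).exp).congr_deriv ?_
  simp only [Pi.div_apply, id]
  ring

lemma hasDerivAt_deriv_exp_neg_div_sub (N R : ℝ) {r : ℝ} (hr : r < R) :
    HasDerivAt (fun t => -N / (R - t) ^ 2 * Real.exp (-N / (R - t)))
      ((N ^ 2 - 2 * N * (R - r)) * ((R - r) ^ 4)⁻¹ * Real.exp (-N / (R - r))) r := by
  have hs : R - r ≠ 0 := (sub_pos.2 hr).ne'
  refine (((hasDerivAt_const r (-N)).div (((hasDerivAt_id r).const_sub R).pow 2)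
    (pow_ne_zero 2 hs)).mul (hasDerivAt_exp_neg_div_sub N R hr)).congr_deriv ?_
  simp only [Pi.div_apply, Pi.pow_apply, id]
  field_simp
  ring

/-- derivative estimates for the radial bump
`f(y) = exp(-(n+2)/(2ε - |y|))` on the annulus `ε ≤ |x| < 2ε`. -/
theorem stmt10 (n : ℕ) (hn : 3 ≤ n) :
    ∃ ε₀ : ℝ, 0 < ε₀ ∧ ε₀ ≤ 1 ∧ ∀ ε : ℝ, 0 < ε → ε ≤ ε₀ →
      ∀ x : EuclideanSpace ℝ (Fin n), ε ≤ ‖x‖ → ‖x‖ < 2 * ε →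
        (((n : ℝ) + 2) * ((2 * ε - ‖x‖) ^ 4)⁻¹ *
            Real.exp (-((n : ℝ) + 2) / (2 * ε - ‖x‖)) ≤
          euclLap (fun y => Real.exp (-((n : ℝ) + 2) / (2 * ε - ‖y‖))) x) ∧
        (gradNorm (fun y => Real.exp (-((n : ℝ) + 2) / (2 * ε - ‖y‖))) x ≤
          ((n : ℝ) + 2) * ε ^ 2 * ((2 * ε - ‖x‖) ^ 4)⁻¹ *
            Real.exp (-((n : ℝ) + 2) / (2 * ε - ‖x‖))) ∧
        (hessNorm (fun y => Real.exp (-((n : ℝ) + 2) / (2 * ε - ‖y‖))) x ≤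
          Real.sqrt n * ((n : ℝ) + 2) ^ 2 * ((2 * ε - ‖x‖) ^ 4)⁻¹ *
            Real.exp (-((n : ℝ) + 2) / (2 * ε - ‖x‖))) := by
  refine ⟨1, one_pos, le_rfl, fun ε hε hε1 x hx hx2 => ?_⟩
  have hrpos : 0 < ‖x‖ := hε.trans_le hx
  have hx0 : x ≠ 0 := norm_pos_iff.1 hrpos
  have hn' : (3 : ℝ) ≤ n := by exact_mod_cast hn
  have hφ : ∀ᶠ r in 𝓝 ‖x‖, HasDerivAt
      (fun t => Real.exp (-((n : ℝ) + 2) / (2 * ε - t))) _ r :=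
    (eventually_lt_nhds hx2).mono fun r hr => hasDerivAt_exp_neg_div_sub ((n : ℝ) + 2) (2 * ε) hr
  have hψ := hasDerivAt_deriv_exp_neg_div_sub ((n : ℝ) + 2) (2 * ε) hx2
  rw [euclLap_radial (φ := fun t => Real.exp (-((n : ℝ) + 2) / (2 * ε - t))) hx0 hφ hψ,
    gradNorm_radial (φ := fun t => Real.exp (-((n : ℝ) + 2) / (2 * ε - t))) hx0 hφ.self_of_nhds,
    hessNorm_radial (φ := fun t => Real.exp (-((n : ℝ) + 2) / (2 * ε - t))) hx0 hφ hψ]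
  set r := ‖x‖
  set N := (n : ℝ) + 2 with hN
  set s := 2 * ε - r with hs
  have hspos : 0 < s := by linarith
  have hsε : s ≤ ε := by linarith
  have hNpos : 0 < N := by linarith
  set K := (s ^ 4)⁻¹ * Real.exp (-N / s) with hK
  have hKpos : 0 < K := by positivity
  have hψK : -N / s ^ 2 * Real.exp (-N / s) = -(N * s ^ 2 * K) := by
    rw [hK]
    field_simp
  obtain ⟨q, hq⟩ : ∃ q, q = s ^ 2 / r := ⟨_, rfl⟩
  have hq0 : 0 ≤ q := by rw [hq]; positivity
  have hqs : q ≤ s := by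
    rw [hq, div_le_iff₀ hrpos]
    nlinarith
  have hψr : -(N * s ^ 2 * K) / r = -(N * q * K) := by
    rw [hq]
    ring
  rw [hψK, hψr]
  simp only [mul_assoc _ (s ^ 4)⁻¹, ← hK]
  refine ⟨?_, ?_, ?_⟩
  · have hcoef : 1 ≤ N - 2 * s - ((n : ℝ) - 1) * q := by nlinarith
    calc N * K ≤ N * K * (N - 2 * s - ((n : ℝ) - 1) * q) :=
          le_mul_of_one_le_right (by positivity) hcoef
      _ = _ := by ring
  · rw [abs_neg, abs_of_nonneg (by positivity)]
    gcongr
  · have hM : 0 ≤ N ^ 2 * K := by positivity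
    have hd : ((N ^ 2 - 2 * N * s) * K) ^ 2 ≤ (N ^ 2 * K) ^ 2 := by
      rw [mul_pow, mul_pow (N ^ 2)]
      refine mul_le_mul_of_nonneg_right (sq_le_sq' ?_ ?_) (sq_nonneg K) <;> nlinarith
    have hb : (-(N * q * K)) ^ 2 ≤ (N ^ 2 * K) ^ 2 := by
      rw [neg_sq]
      have : N * q ≤ N ^ 2 := by nlinarith
      gcongr
    rw [mul_assoc (Real.sqrt n), ← Real.sqrt_sq hM, ← Real.sqrt_mul (by positivity)]
    apply Real.sqrt_le_sqrt
    nlinarith [mul_le_mul_of_nonneg_left hb (by linarith : (0 : ℝ) ≤ (n : ℝ) - 1)]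

end
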